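/- arXiv:2405.09231 — 5 statements merged into one kernel-verified Lean document; each statement's English description precedes it below -/
import Mathlib

section
/- Let K be a field extension of a field F. If I and J are finite subsets of K that are each algebraically independent over F and |I| < |J|, then there exists an element y in J \ I such that I ∪ {y} is algebraically independent over F. -/
/-- Let `K` be a field extension of a field `F`. If `I` and `J` are finite
subsets of `K` that are each algebraically independent over `F` and `|I| < |J|`, then there
exists `y ∈ J \ I` such that `I ∪ {y}` is algebraically independent over `F`. -/
theorem algebraicIndependent_exchange
    {F K : Type*} [Field F] [Field K] [Algebra F K] (I J : Finset K)
    (hI : AlgebraicIndependent F ((↑) : ((I : Set K)) → K))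
    (hJ : AlgebraicIndependent F ((↑) : ((J : Set K)) → K))
    (hcard : I.card < J.card) :
    ∃ y ∈ J, y ∉ I ∧
      AlgebraicIndependent F ((↑) : (insert y (I : Set K) : Set K) → K) := by
  have h := Matroid.Indep.augment (M := AlgebraicIndependent.matroid F K)
    (I := (I : Set K)) (J := (J : Set K)) hI hJ (by simpa using hcard)
  obtain ⟨y, hy, hyI⟩ := h
  exact ⟨y, hy.1, hy.2, hyI⟩
end

section
/- Let B be an n × n integer matrix that is skew-symmetrizable, i.e., there exist positive integers d_1, …, d_n such that d_i b_{ij} = −d_j b_{ji} for all i, j. Then for every index k with 1 ≤ k ≤ n, the mutated matrix μ_k(B) is skew-symmetrizable with the same d_1, …, d_n: writing B' = μ_k(B), one has d_i b'_{ij} = −d_j b'_{ji} for all i, j. -/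
/-- The mutation `μ_k(B)` of an `n × n` integer matrix `B` at an index `k`: the entry
`b'_{ij}` is `−b_{ij}` if `i = k` or `j = k`, and
`b_{ij} + (|b_{ik}| b_{kj} + b_{ik} |b_{kj}|)/2` otherwise.  (The numerator is always
even, so integer division by `2` is exact.) -/
def matrixMutation {n : ℕ} (B : Matrix (Fin n) (Fin n) ℤ) (k : Fin n) :
    Matrix (Fin n) (Fin n) ℤ :=
  Matrix.of fun i j =>
    if i = k ∨ j = k then -B i j
    else B i j + (|B i k| * B k j + B i k * |B k j|) / 2

/-- If `B` is an `n × n` integer matrix that is skew-symmetrizable via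
positive integers `d_1, …, d_n` (i.e. `d_i b_{ij} = −d_j b_{ji}` for all `i, j`), then
for every index `k` the mutated matrix `μ_k(B)` is skew-symmetrizable with the same
`d_1, …, d_n`. -/
theorem matrixMutation_skewSymmetrizable {n : ℕ} (B : Matrix (Fin n) (Fin n) ℤ)
    (d : Fin n → ℤ) (hd : ∀ i, 0 < d i)
    (hskew : ∀ i j, d i * B i j = -(d j * B j i)) (k : Fin n) :
    ∀ i j, d i * matrixMutation B k i j = -(d j * matrixMutation B k j i) := by
  have habs : ∀ i j, d i * |B i j| = d j * |B j i| := by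
    intro i j
    have h := congrArg abs (hskew i j)
    rwa [abs_neg, abs_mul, abs_mul, abs_of_pos (hd i), abs_of_pos (hd j)] at h
  have heven : ∀ a b : ℤ, (|a| * b + a * |b|) / 2 * 2 = |a| * b + a * |b| := by
    intro a b
    apply Int.ediv_mul_cancel
    rcases abs_choice a with ha | ha <;> rcases abs_choice b with hb | hb <;> rw [ha, hb]
    · exact ⟨a * b, by ring⟩
    · exact ⟨0, by ring⟩
    · exact ⟨0, by ring⟩
    · exact ⟨-(a * b), by ring⟩
  intro i j
  by_cases h : i = k ∨ j = k
  · have h' : j = k ∨ i = k := h.symm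
    simp only [matrixMutation, Matrix.of_apply, if_pos h, if_pos h']
    linarith [hskew i j]
  · have h' : ¬ (j = k ∨ i = k) := fun q => h q.symm
    simp only [matrixMutation, Matrix.of_apply, if_neg h, if_neg h']
    have e1 := heven (B i k) (B k j)
    have e2 := heven (B j k) (B k i)
    have key : d i * (|B i k| * B k j + B i k * |B k j|)
        = -(d j * (|B j k| * B k i + B j k * |B k i|)) := by
      linear_combination B k j * habs i k + |B k j| * hskew i k
        + |B k i| * hskew k j - B k i * habs k j
    rw [← e1, ← e2] at key
    linarith [hskew i j]
end

section
/- Let K be a field extension of a field F, let x_1, …, x_n be elements of K that are algebraically independent over F, and let f be a nonzero polynomial over F in the variables X_1, …, X_{n−1}. Set y = f(x_1, …, x_{n−1}) / x_n (this is well defined since x_n ≠ 0). Then the elements x_1, …, x_{n−1}, y are algebraically independent over F. -/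
/-- Let `K` be a field extension of a field `F`, let
`x_1, …, x_{n+1}` be elements of `K` that are algebraically independent over `F`, and
let `f` be a nonzero polynomial over `F` in `n` variables.  Set
`y = f(x_1, …, x_n) / x_{n+1}`.  Then `x_1, …, x_n, y` are algebraically independent
over `F`. -/
theorem algebraicIndependent_update_div
    {F K : Type*} [Field F] [Field K] [Algebra F K] {n : ℕ}
    (x : Fin (n + 1) → K) (hx : AlgebraicIndependent F x)
    (f : MvPolynomial (Fin n) F) (hf : f ≠ 0) :
    AlgebraicIndependent F
      (Function.update x (Fin.last n)
        (MvPolynomial.aeval (fun i : Fin n => x i.castSucc) f / x (Fin.last n))) := by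
  classical
  set y := MvPolynomial.aeval (fun i : Fin n => x i.castSucc) f / x (Fin.last n) with hy
  rw [AlgebraicIndependent.iff_transcendental_adjoin_image (Fin.last n)] at hx ⊢
  have himg : Function.update x (Fin.last n) y '' {Fin.last n}ᶜ = x '' {Fin.last n}ᶜ := by
    apply Set.image_congr
    intro i hi
    exact Function.update_of_ne hi _ _
  have hfun : (fun i : {j // j ≠ Fin.last n} => Function.update x (Fin.last n) y i)
      = fun i : {j // j ≠ Fin.last n} => x i := by
    funext i
    exact Function.update_of_ne i.2 _ _
  rw [himg, hfun, Function.update_self]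
  obtain ⟨h1, h2⟩ := hx
  refine ⟨h1, fun hyalg => h2 ?_⟩
  set S := Algebra.adjoin F (x '' {Fin.last n}ᶜ) with hS
  have hinj : AlgebraicIndependent F (fun i : Fin n => x i.castSucc) :=
    h1.comp (fun i : Fin n => (⟨i.castSucc, (Fin.castSucc_lt_last i).ne⟩ : {j // j ≠ Fin.last n}))
      (fun a b h => by simpa using h)
  set z := MvPolynomial.aeval (fun i : Fin n => x i.castSucc) f with hz
  have hz0 : z ≠ 0 := fun h => hf (hinj (by rw [← hz, h, map_zero]))
  have hzS : z ∈ S := by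
    have : z ∈ Algebra.adjoin F (Set.range fun i : Fin n => x i.castSucc) := by
      rw [Algebra.adjoin_range_eq_range_aeval]
      exact ⟨f, rfl⟩
    refine Algebra.adjoin_mono ?_ this
    rintro _ ⟨i, rfl⟩
    exact ⟨i.castSucc, (Fin.castSucc_lt_last i).ne, rfl⟩
  have hxe : x (Fin.last n) = z * y⁻¹ := by
    rw [hy, inv_div, mul_div_cancel₀ _ hz0]
  rw [hxe]
  exact (isAlgebraic_algebraMap (⟨z, hzS⟩ : S)).mul hyalg.inv
end

section
/- In the field K = ℚ(x_1, x_2) of rational functions in two variables over ℚ, consider the five elements y_1 = x_1, y_2 = x_2, y_3 = (1 + x_2)/x_1, y_4 = (1 + x_1 + x_2)/(x_1 x_2), and y_5 = (1 + x_1)/x_2. These five elements are pairwise distinct, and every two-element subset of {y_1, y_2, y_3, y_4, y_5} is algebraically independent over ℚ. In particular, the matroid on the ground set {y_1, …, y_5} whose independent sets are the subsets that are algebraically independent over ℚ is the uniform matroid U_{2,5}. -/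
theorem cluster_trdeg
    {K : Type*} [Field K] [Algebra ℚ K] [Algebra (MvPolynomial (Fin 2) ℚ) K]
    [IsScalarTower ℚ (MvPolynomial (Fin 2) ℚ) K]
    [IsFractionRing (MvPolynomial (Fin 2) ℚ) K] : Algebra.trdeg ℚ K = 2 := by
  have halg : Algebra.IsAlgebraic (MvPolynomial (Fin 2) ℚ) K :=
    IsLocalization.isAlgebraic _ (nonZeroDivisors (MvPolynomial (Fin 2) ℚ))
  have hinj : FaithfulSMul (MvPolynomial (Fin 2) ℚ) K :=
    (faithfulSMul_iff_algebraMap_injective _ _).2 (IsFractionRing.injective _ _)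
  have h := (IsTranscendenceBasis.mvPolynomial (Fin 2) ℚ).algebraMap_comp (A := K)
  have := h.lift_cardinalMk_eq_trdeg
  simpa using this.symm

theorem cluster_pair
    {K : Type*} [Field K] [Algebra ℚ K] [Algebra (MvPolynomial (Fin 2) ℚ) K]
    [IsScalarTower ℚ (MvPolynomial (Fin 2) ℚ) K]
    [IsFractionRing (MvPolynomial (Fin 2) ℚ) K] (a b : K)
    (h : ∀ L : IntermediateField ℚ K, a ∈ L → b ∈ L →
      ∀ i, algebraMap (MvPolynomial (Fin 2) ℚ) K (MvPolynomial.X i) ∈ L) :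
    AlgebraicIndependent ℚ ![a, b] := by
  have hX := h (IntermediateField.adjoin ℚ (Set.range ![a, b]))
    (IntermediateField.subset_adjoin _ _ ⟨0, rfl⟩) (IntermediateField.subset_adjoin _ _ ⟨1, rfl⟩)
  generalize hL : IntermediateField.adjoin ℚ (Set.range ![a, b]) = L at hX
  have hp : ∀ p : MvPolynomial (Fin 2) ℚ, algebraMap _ K p ∈ L := by
    intro p
    induction p using MvPolynomial.induction_on with
    | C r =>
      rw [← MvPolynomial.algebraMap_eq, ← IsScalarTower.algebraMap_apply]
      exact L.algebraMap_mem r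
    | add p q hp hq => rw [map_add]; exact L.add_mem hp hq
    | mul_X p i hp => rw [map_mul]; exact L.mul_mem hp (hX i)
  have hall : ∀ z : K, z ∈ L := by
    intro z
    obtain ⟨p, q, _, rfl⟩ := IsFractionRing.div_surjective (A := MvPolynomial (Fin 2) ℚ) z
    exact L.div_mem (hp p) (hp q)
  have halg : Algebra.IsAlgebraic (Algebra.adjoin ℚ (Set.range ![a, b])) K := by
    constructor
    intro z
    have hz := hall z
    rw [← hL, IntermediateField.mem_adjoin_iff_div] at hz
    obtain ⟨r, hr, s, hs, rfl⟩ := hz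
    rw [div_eq_mul_inv]
    exact (isAlgebraic_algebraMap (⟨r, hr⟩ : Algebra.adjoin ℚ (Set.range ![a, b]))).mul
      (isAlgebraic_algebraMap (⟨s, hs⟩ : Algebra.adjoin ℚ (Set.range ![a, b]))).inv
  refine (Algebra.IsAlgebraic.isTranscendenceBasis_of_lift_le_trdeg_of_finite (R := ℚ) ![a, b] ?_).1
  rw [cluster_trdeg]
  simp

theorem cluster_pentagon {K : Type*} [Field K] [Algebra ℚ K] (L : IntermediateField ℚ K)
    (y : Fin 5 → K) (h0 : ∀ i, y i ≠ 0) (hy : ∀ i, y i * y (i + 2) = 1 + y (i + 1))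
    (i j : Fin 5) (hij : i ≠ j) (hi : y i ∈ L) (hj : y j ∈ L) (k : Fin 5) : y k ∈ L := by
  have step : ∀ i, y i ∈ L → y (i + 1) ∈ L → y (i + 2) ∈ L := by
    intro i h1 h2
    have : y (i + 2) = (1 + y (i + 1)) / y i := by
      rw [← hy i, mul_div_cancel_left₀ _ (h0 i)]
    rw [this]
    exact L.div_mem (L.add_mem L.one_mem h2) h1
  have mid : ∀ i, y i ∈ L → y (i + 2) ∈ L → y (i + 1) ∈ L := by
    intro i h1 h2
    have : y (i + 1) = y i * y (i + 2) - 1 := by rw [hy i]; ring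
    rw [this]
    exact L.sub_mem (L.mul_mem h1 h2) L.one_mem
  have adj : ∀ i, y i ∈ L → y (i + 1) ∈ L → ∀ k, y k ∈ L := by
    intro i h1 h2 k
    have h3 := step i h1 h2
    have h4 := step (i + 1) h2 (by convert h3 using 2; grind)
    have h5 := step (i + 2) h3 (by convert h4 using 2; grind)
    have : k = i ∨ k = i + 1 ∨ k = i + 2 ∨ k = i + 1 + 2 ∨ k = i + 2 + 2 := by
      clear * -; revert i k; decide
    rcases this with rfl | rfl | rfl | rfl | rfl <;> assumption
  have : j = i + 1 ∨ j = i + 2 ∨ i = j + 2 ∨ i = j + 1 := by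
    clear * - hij; revert i j; decide
  rcases this with rfl | rfl | rfl | rfl
  · exact adj _ hi hj k
  · exact adj _ hi (mid _ hi hj) k
  · exact adj _ hj (mid _ hj hi) k
  · exact adj _ hj hi k

/-- In `K = ℚ(x₁, x₂)`, the five elements `y₁ = x₁`, `y₂ = x₂`,
`y₃ = (1 + x₂)/x₁`, `y₄ = (1 + x₁ + x₂)/(x₁x₂)`, `y₅ = (1 + x₁)/x₂` are pairwise
distinct, every two-element subset of `{y₁, …, y₅}` is algebraically independent over
`ℚ`, and the matroid on `{y₁, …, y₅}` whose independent sets are the algebraically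
independent subsets is the uniform matroid `U_{2,5}`: a subset of `{y₁, …, y₅}` is
algebraically independent over `ℚ` if and only if it has at most two elements. -/
theorem cluster_matroid_U25
    {K : Type*} [Field K] [Algebra ℚ K] [Algebra (MvPolynomial (Fin 2) ℚ) K]
    [IsScalarTower ℚ (MvPolynomial (Fin 2) ℚ) K]
    [IsFractionRing (MvPolynomial (Fin 2) ℚ) K] :
    let x₁ : K := algebraMap (MvPolynomial (Fin 2) ℚ) K (MvPolynomial.X 0)
    let x₂ : K := algebraMap (MvPolynomial (Fin 2) ℚ) K (MvPolynomial.X 1)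
    let y : Fin 5 → K :=
      ![x₁, x₂, (1 + x₂) / x₁, (1 + x₁ + x₂) / (x₁ * x₂), (1 + x₁) / x₂]
    Function.Injective y ∧
    (∀ i j : Fin 5, i ≠ j → AlgebraicIndependent ℚ ![y i, y j]) ∧
    (∀ S : Finset K, (S : Set K) ⊆ Set.range y →
      (AlgebraicIndependent ℚ ((↑) : ((S : Set K)) → K) ↔ S.card ≤ 2)) := by
  intro x₁ x₂ y
  have hne : ∀ p : MvPolynomial (Fin 2) ℚ, MvPolynomial.eval (fun _ => (1 : ℚ)) p ≠ 0 →
      algebraMap (MvPolynomial (Fin 2) ℚ) K p ≠ 0 := by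
    intro p hp h
    rw [map_eq_zero_iff _ (IsFractionRing.injective (MvPolynomial (Fin 2) ℚ) K)] at h
    simp [h] at hp
  have hx₁ : x₁ ≠ 0 := hne _ (by simp)
  have hx₂ : x₂ ≠ 0 := hne _ (by simp)
  have h1 : 1 + x₁ ≠ 0 := by
    have := hne (1 + MvPolynomial.X 0) (by simp)
    simpa using this
  have h2 : 1 + x₂ ≠ 0 := by
    have := hne (1 + MvPolynomial.X 1) (by simp)
    simpa using this
  have h3 : 1 + x₁ + x₂ ≠ 0 := by
    have := hne (1 + MvPolynomial.X 0 + MvPolynomial.X 1) (by simp; norm_num)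
    simpa using this
  have e0 : y 0 = x₁ := rfl
  have e1 : y 1 = x₂ := rfl
  have e2 : y 2 = (1 + x₂) / x₁ := rfl
  have e3 : y 3 = (1 + x₁ + x₂) / (x₁ * x₂) := rfl
  have e4 : y 4 = (1 + x₁) / x₂ := rfl
  clear_value y
  have h0 : ∀ i, y i ≠ 0 := by
    intro i
    fin_cases i <;> simp [e0, e1, e2, e3, e4, hx₁, hx₂, h1, h2, h3]
  have hy : ∀ i, y i * y (i + 2) = 1 + y (i + 1) := by
    intro i
    fin_cases i
    · change y 0 * y 2 = 1 + y 1
      rw [e0, e1, e2]; field_simp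
    · change y 1 * y 3 = 1 + y 2
      rw [e1, e2, e3]; field_simp; ring
    · change y 2 * y 4 = 1 + y 3
      rw [e2, e3, e4]; field_simp; ring
    · change y 3 * y 0 = 1 + y 4
      rw [e3, e4, e0]; field_simp; ring
    · change y 4 * y 1 = 1 + y 0
      rw [e4, e0, e1]; field_simp
  have hpair : ∀ i j : Fin 5, i ≠ j → AlgebraicIndependent ℚ ![y i, y j] := by
    intro i j hij
    apply cluster_pair
    intro L hi hj k
    have hk := cluster_pentagon L y h0 hy i j hij hi hj
    fin_cases k
    · have := hk 0
      rwa [e0] at this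
    · have := hk 1
      rwa [e1] at this
  have hinj : Function.Injective y := by
    intro i j h
    by_contra hij
    have := (hpair i j hij).injective (a₁ := 0) (a₂ := 1) (by simpa using h)
    simp at this
  refine ⟨hinj, hpair, ?_⟩
  classical
  intro S hS
  constructor
  · intro h
    have := h.cardinalMk_le_trdeg
    rw [cluster_trdeg] at this
    simpa using this
  · intro hc
    have hS' : S ⊆ Finset.univ.image y := by
      intro s hs
      obtain ⟨i, rfl⟩ := hS hs
      simp
    obtain ⟨T, hST, hT, hT2⟩ := Finset.exists_subsuperset_card_eq hS' hc
      (by rw [Finset.card_image_of_injective _ hinj]; simp)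
    obtain ⟨a, b, hab, rfl⟩ := Finset.card_eq_two.1 hT2
    obtain ⟨i, -, rfl⟩ := Finset.mem_image.1 (hT (Finset.mem_insert_self a _))
    obtain ⟨j, -, rfl⟩ := Finset.mem_image.1 (hT (Finset.mem_insert_of_mem (Finset.mem_singleton_self b)))
    have hij : i ≠ j := fun h => hab (by rw [h])
    refine AlgebraicIndependent.mono ?_ (hpair i j hij).coe_range
    intro s hs
    have := hST hs
    simp only [Finset.mem_insert, Finset.mem_singleton] at this
    rcases this with rfl | rfl
    · exact ⟨0, rfl⟩
    · exact ⟨1, rfl⟩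
end

section
/- Label the vertices of a convex m-gon (m ≥ 3) by 1, …, m in cyclic order. Call a pair {a, b} of vertices a diagonal if a and b are neither equal nor adjacent in the cyclic order, and say two diagonals {a, b} (with a < b) and {c, d} (with c < d) cross if a < c < b < d or c < a < d < b. Then every set of pairwise noncrossing diagonals that is maximal with respect to inclusion has exactly m − 3 elements. -/
/-- A pair `{a, b}` of vertices of a convex `m`-gon (vertices `1, …, m` in cyclic order)
is a diagonal if `a` and `b` are neither equal nor adjacent in the cyclic order. -/
def IsPolygonDiagonal (m : ℕ) (p : Finset ℕ) : Prop :=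
  ∃ a b : ℕ, 1 ≤ a ∧ a < b ∧ b ≤ m ∧ p = {a, b} ∧ b - a ≠ 1 ∧ ¬(a = 1 ∧ b = m)

/-- Two diagonals `{a, b}` (with `a < b`) and `{c, d}` (with `c < d`) cross if
`a < c < b < d` or `c < a < d < b`. -/
def DiagCross (p q : Finset ℕ) : Prop :=
  ∃ a b c d : ℕ, a < b ∧ c < d ∧ p = {a, b} ∧ q = {c, d} ∧
    ((a < c ∧ c < b ∧ b < d) ∨ (c < a ∧ a < d ∧ d < b))

theorem pair_inj_aux {a b c d : ℕ} (h1 : a < b) (h2 : c < d)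
    (h : ({a, b} : Finset ℕ) = {c, d}) : a = c ∧ b = d := by
  have e1 : a ∈ ({c, d} : Finset ℕ) := by rw [← h]; simp
  have e2 : b ∈ ({c, d} : Finset ℕ) := by rw [← h]; simp
  have e3 : c ∈ ({a, b} : Finset ℕ) := by rw [h]; simp
  have e4 : d ∈ ({a, b} : Finset ℕ) := by rw [h]; simp
  simp only [Finset.mem_insert, Finset.mem_singleton] at e1 e2 e3 e4
  omega

theorem count_aux (m : ℕ) (P : Finset (ℕ × ℕ))
    (h1 : ∀ a b, (a, b) ∈ P → 1 ≤ a ∧ a < b ∧ b ≤ m)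
    (h2 : ∀ a b c d, (a, b) ∈ P → (c, d) ∈ P → ¬ (a < c ∧ c < b ∧ b < d))
    (h3 : ∀ a b, 1 ≤ a → a < b → b ≤ m → (∀ c d, (c, d) ∈ P →
      ¬ (a < c ∧ c < b ∧ b < d) ∧ ¬ (c < a ∧ a < d ∧ d < b)) → (a, b) ∈ P) :
    ∀ n i j, j - i = n → (i, j) ∈ P →
      (P.filter (fun p => i ≤ p.1 ∧ p.2 ≤ j)).card + 1 = 2 * n := by
  intro n
  induction n using Nat.strong_induction_on with
  | _ n ih =>
  intro i j hn hij
  obtain ⟨hi, hlt, hj⟩ := h1 i j hij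
  by_cases hn1 : n = 1
  · have : P.filter (fun p => i ≤ p.1 ∧ p.2 ≤ j) = {(i, j)} := by
      ext ⟨a, b⟩
      simp only [Finset.mem_filter, Finset.mem_singleton, Prod.mk.injEq]
      constructor
      · rintro ⟨h, h', h''⟩
        have := h1 a b h
        omega
      · rintro ⟨rfl, rfl⟩
        exact ⟨hij, le_rfl, le_rfl⟩
    rw [this, hn1]; rfl
  · have hside : (i, i + 1) ∈ P := by
      apply h3 <;> first | omega | skip
    let K := (Finset.Ioo i j).filter (fun k => (i, k) ∈ P)
    have hK : K.Nonempty := ⟨i + 1, by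
      simp only [K, Finset.mem_filter, Finset.mem_Ioo]
      exact ⟨by omega, hside⟩⟩
    obtain ⟨k, hkK, hkmax⟩ := K.exists_max_image id hK
    simp only [K, Finset.mem_filter, Finset.mem_Ioo, id] at hkK hkmax
    obtain ⟨⟨hik, hkj⟩, hikP⟩ := hkK
    have hmaxk : ∀ d, (i, d) ∈ P → k < d → d < j → False := by
      intro d hd hkd hdj
      have := hkmax d ⟨⟨by omega, hdj⟩, hd⟩
      omega
    have hkjP : (k, j) ∈ P := by
      apply h3 <;> first | omega | skip
      intro c d hcd
      have e1 := h2 _ _ _ _ hij hcd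
      have e2 := h2 _ _ _ _ hcd hij
      have e3 := h2 _ _ _ _ hikP hcd
      refine ⟨by omega, fun h => ?_⟩
      have : c = i := by omega
      subst this
      exact hmaxk d hcd h.2.1 h.2.2
    have c1 := ih (k - i) (by omega) i k rfl hikP
    have c2 := ih (j - k) (by omega) k j rfl hkjP
    have hu : P.filter (fun p => i ≤ p.1 ∧ p.2 ≤ j) =
        insert (i, j) (P.filter (fun p => i ≤ p.1 ∧ p.2 ≤ k) ∪
          P.filter (fun p => k ≤ p.1 ∧ p.2 ≤ j)) := by
      ext ⟨a, b⟩
      simp only [Finset.mem_filter, Finset.mem_insert, Finset.mem_union, Prod.mk.injEq]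
      constructor
      · rintro ⟨h, h', h''⟩
        have e3 := h2 _ _ _ _ hikP h
        by_cases hs : a < k ∧ k < b
        · have : a = i := by omega
          subst this
          have : ¬ b < j := hmaxk b h hs.2
          left; omega
        · simp only [h, true_and]
          omega
      · rintro (⟨rfl, rfl⟩ | ⟨h, h'⟩ | ⟨h, h'⟩)
        · exact ⟨hij, le_rfl, le_rfl⟩
        · exact ⟨h, by omega⟩
        · exact ⟨h, by omega⟩
    rw [hu, Finset.card_insert_of_notMem, Finset.card_union_of_disjoint]
    · omega
    · rw [Finset.disjoint_left]
      rintro ⟨a, b⟩ ha hb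
      simp only [Finset.mem_filter] at ha hb
      have := h1 _ _ ha.1
      omega
    · simp only [Finset.mem_filter, Finset.mem_union]
      omega

/-- In a convex `m`-gon (`m ≥ 3`), every set of pairwise noncrossing
diagonals that is maximal with respect to inclusion has exactly `m − 3` elements. -/
theorem maximal_noncrossing_card (m : ℕ) (hm : 3 ≤ m) (S : Finset (Finset ℕ))
    (hdiag : ∀ p ∈ S, IsPolygonDiagonal m p)
    (hnc : ∀ p ∈ S, ∀ q ∈ S, p ≠ q → ¬ DiagCross p q)
    (hmax : ∀ T : Finset (Finset ℕ), (∀ p ∈ T, IsPolygonDiagonal m p) →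
      (∀ p ∈ T, ∀ q ∈ T, p ≠ q → ¬ DiagCross p q) → S ⊆ T → S = T) :
    S.card = m - 3 := by
  classical
  have hS : ∀ a b, a < b → ({a, b} : Finset ℕ) ∈ S →
      1 ≤ a ∧ b ≤ m ∧ b ≠ a + 1 ∧ ¬ (a = 1 ∧ b = m) := by
    intro a b hab h
    obtain ⟨a', b', g1, g2, g3, g4, g5, g6⟩ := hdiag _ h
    obtain ⟨rfl, rfl⟩ := pair_inj_aux hab g2 g4
    exact ⟨g1, g3, by omega, g6⟩
  have hSnc : ∀ a b c d, a < b → c < d → ({a, b} : Finset ℕ) ∈ S → ({c, d} : Finset ℕ) ∈ S →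
      ¬ (a < c ∧ c < b ∧ b < d) := by
    intro a b c d hab hcd h h' hx
    refine hnc _ h _ h' ?_ ⟨a, b, c, d, hab, hcd, rfl, rfl, Or.inl hx⟩
    intro e
    have := pair_inj_aux hab hcd e
    omega
  let P : Finset (ℕ × ℕ) := (Finset.Icc 1 m ×ˢ Finset.Icc 1 m).filter
    (fun p => p.1 < p.2 ∧ (p.2 = p.1 + 1 ∨ (p.1 = 1 ∧ p.2 = m) ∨ ({p.1, p.2} : Finset ℕ) ∈ S))
  have hP : ∀ a b, (a, b) ∈ P ↔ (1 ≤ a ∧ a < b ∧ b ≤ m) ∧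
      (b = a + 1 ∨ (a = 1 ∧ b = m) ∨ ({a, b} : Finset ℕ) ∈ S) := by
    intro a b
    simp only [P, Finset.mem_filter, Finset.mem_product, Finset.mem_Icc]
    constructor
    · rintro ⟨h, h', h''⟩
      exact ⟨by omega, h''⟩
    · rintro ⟨h, h'⟩
      exact ⟨by omega, by omega, h'⟩
  have h1 : ∀ a b, (a, b) ∈ P → 1 ≤ a ∧ a < b ∧ b ≤ m := fun a b h => ((hP a b).1 h).1
  have h2 : ∀ a b c d, (a, b) ∈ P → (c, d) ∈ P → ¬ (a < c ∧ c < b ∧ b < d) := by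
    intro a b c d h h'
    obtain ⟨e1, e2⟩ := (hP _ _).1 h
    obtain ⟨f1, f2⟩ := (hP _ _).1 h'
    rcases e2 with e2 | e2 | e2
    · omega
    · omega
    · rcases f2 with f2 | f2 | f2
      · omega
      · omega
      · exact hSnc a b c d e1.2.1 f1.2.1 e2 f2
  have h3 : ∀ a b, 1 ≤ a → a < b → b ≤ m → (∀ c d, (c, d) ∈ P →
      ¬ (a < c ∧ c < b ∧ b < d) ∧ ¬ (c < a ∧ a < d ∧ d < b)) → (a, b) ∈ P := by
    intro a b ha hab hb hcr
    rw [hP]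
    refine ⟨⟨ha, hab, hb⟩, ?_⟩
    by_cases g1 : b = a + 1
    · exact Or.inl g1
    by_cases g2 : a = 1 ∧ b = m
    · exact Or.inr (Or.inl g2)
    refine Or.inr (Or.inr ?_)
    have hd : IsPolygonDiagonal m {a, b} := ⟨a, b, ha, hab, hb, rfl, by omega, g2⟩
    have key : ∀ c d, c < d → ({c, d} : Finset ℕ) ∈ S →
        ¬ (a < c ∧ c < b ∧ b < d) ∧ ¬ (c < a ∧ a < d ∧ d < b) := by
      intro c d hcd h
      have := hS c d hcd h
      exact hcr c d ((hP c d).2 ⟨⟨this.1, hcd, this.2.1⟩, Or.inr (Or.inr h)⟩)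
    have := hmax (insert {a, b} S) ?_ ?_ (Finset.subset_insert _ _)
    · rw [this]; exact Finset.mem_insert_self _ _
    · intro p hp
      rcases Finset.mem_insert.1 hp with rfl | hp
      · exact hd
      · exact hdiag p hp
    · intro p hp q hq hpq
      rcases Finset.mem_insert.1 hp with rfl | hp <;> rcases Finset.mem_insert.1 hq with rfl | hq
      · exact absurd rfl hpq
      · rintro ⟨a', b', c, d, k1, k2, k3, k4, k5⟩
        obtain ⟨rfl, rfl⟩ := pair_inj_aux hab k1 k3
        subst k4
        have := key c d k2 hq
        omega
      · rintro ⟨c, d, a', b', k2, k1, k4, k3, k5⟩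
        obtain ⟨rfl, rfl⟩ := pair_inj_aux hab k1 k3
        subst k4
        have := key c d k2 hp
        omega
      · exact hnc p hp q hq hpq
  have hcount := count_aux m P h1 h2 h3 (m - 1) 1 m rfl
    ((hP 1 m).2 ⟨by omega, Or.inr (Or.inl ⟨rfl, rfl⟩)⟩)
  have hfull : P.filter (fun p => 1 ≤ p.1 ∧ p.2 ≤ m) = P := by
    apply Finset.filter_true_of_mem
    rintro ⟨a, b⟩ h
    have := h1 a b h
    exact ⟨this.1, this.2.2⟩
  rw [hfull] at hcount
  let D := P.filter (fun p => ({p.1, p.2} : Finset ℕ) ∈ S)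
  have hDS : D.card = S.card := by
    apply Finset.card_bij (fun p _ => ({p.1, p.2} : Finset ℕ))
    · intro p hp
      exact (Finset.mem_filter.1 hp).2
    · rintro ⟨a, b⟩ hp ⟨c, d⟩ hq h
      have e1 := h1 _ _ (Finset.mem_filter.1 hp).1
      have e2 := h1 _ _ (Finset.mem_filter.1 hq).1
      obtain ⟨rfl, rfl⟩ := pair_inj_aux e1.2.1 e2.2.1 h
      rfl
    · intro p hp
      obtain ⟨a, b, g1, g2, g3, g4, g5, g6⟩ := hdiag p hp
      subst g4
      exact ⟨(a, b), Finset.mem_filter.2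
        ⟨(hP a b).2 ⟨⟨g1, g2, g3⟩, Or.inr (Or.inr hp)⟩, hp⟩, rfl⟩
  let B : Finset (ℕ × ℕ) := insert (1, m) ((Finset.Icc 1 (m - 1)).image (fun a => (a, a + 1)))
  have hB : B.card = m := by
    rw [Finset.card_insert_of_notMem, Finset.card_image_of_injective, Nat.card_Icc]
    · omega
    · intro x y h
      exact (Prod.mk.inj h).1
    · simp only [Finset.mem_image, Prod.mk.injEq, not_exists]
      omega
  have hBm : ∀ a b, (a, b) ∈ B ↔ (a = 1 ∧ b = m) ∨ (1 ≤ a ∧ a + 1 ≤ m ∧ b = a + 1) := by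
    intro a b
    simp only [B, Finset.mem_insert, Finset.mem_image, Prod.mk.injEq, Finset.mem_Icc]
    constructor
    · rintro (h | ⟨c, h⟩) <;> omega
    · rintro (h | h)
      · exact Or.inl h
      · exact Or.inr ⟨a, by omega⟩
  have hPBD : P = B ∪ D := by
    ext ⟨a, b⟩
    simp only [Finset.mem_union, hBm, D, Finset.mem_filter, hP]
    constructor
    · rintro ⟨h, h' | h' | h'⟩
      · left; right; omega
      · left; left; exact h'
      · exact Or.inr ⟨⟨h, Or.inr (Or.inr h')⟩, h'⟩
    · rintro ((h | h) | h)
      · exact ⟨by omega, Or.inr (Or.inl h)⟩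
      · exact ⟨by omega, Or.inl h.2.2⟩
      · exact h.1
  have hdis : Disjoint B D := by
    rw [Finset.disjoint_left]
    rintro ⟨a, b⟩ h h'
    rw [hBm] at h
    have e := Finset.mem_filter.1 h'
    have := hS a b (h1 _ _ e.1).2.1 e.2
    omega
  rw [hPBD, Finset.card_union_of_disjoint hdis, hB, hDS] at hcount
  omega
end
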